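/- For any function u in H^1_0 of a domain in R^3, the L^4 norm of u is bounded by (4/(3√3))^{3/4} times the L^2 norm of u to the power 1/4 times the L^2 norm of the gradient of u to the power 3/4. -/

import Mathlib

open MeasureTheory
open scoped ENNReal

local notation "E3" => EuclideanSpace ℝ (Fin 3)

lemma lady_cs {α : Type*} [MeasurableSpace α] (μ : Measure α) {f g : α → ℝ≥0∞}
    (hf : Measurable f) (hg : Measurable g) :
    ∫⁻ x, f x * g x ∂μ ≤ (∫⁻ x, f x ^ 2 ∂μ) ^ (1 / 2 : ℝ) * (∫⁻ x, g x ^ 2 ∂μ) ^ (1 / 2 : ℝ) := by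
  have := ENNReal.lintegral_mul_le_Lp_mul_Lq μ Real.HolderConjugate.two_two
    hf.aemeasurable hg.aemeasurable
  simpa using this

lemma lady_half (x : ℝ≥0∞) : x ^ (1 / 2 : ℝ) * x ^ (1 / 2 : ℝ) = x := by
  rw [← ENNReal.rpow_add_of_nonneg _ _ (by norm_num) (by norm_num)]; norm_num

lemma lady_half_sq (x : ℝ≥0∞) : (x ^ (1 / 2 : ℝ)) ^ 2 = x := by
  rw [sq, lady_half]

lemma lady_2d {F f g : ℝ × ℝ → ℝ≥0∞} (hF : Measurable F) (hf : Measurable f) (hg : Measurable g)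
    (h1 : ∀ y z, F (y, z) ^ 2 ≤ ∫⁻ t, F (t, z) * f (t, z))
    (h2 : ∀ y z, F (y, z) ^ 2 ≤ ∫⁻ t, F (y, t) * g (y, t)) :
    ∫⁻ p, F p ^ 4 ≤ (∫⁻ p, F p ^ 2) *
      ((∫⁻ p, f p ^ 2) ^ (1 / 2 : ℝ) * (∫⁻ p, g p ^ 2) ^ (1 / 2 : ℝ)) := by
  have mf : Measurable fun p => F p * f p := hF.mul hf
  have mg : Measurable fun p => F p * g p := hF.mul hg
  have m1 : Measurable fun z => ∫⁻ t, F (t, z) * f (t, z) := mf.lintegral_prod_left'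
  have m2 : Measurable fun y => ∫⁻ t, F (y, t) * g (y, t) := mg.lintegral_prod_right'
  have e1 : ∫⁻ z, ∫⁻ t, F (t, z) * f (t, z) = ∫⁻ p, F p * f p := by
    rw [Measure.volume_eq_prod, lintegral_prod_symm _ mf.aemeasurable]
  have e2 : ∫⁻ y, ∫⁻ t, F (y, t) * g (y, t) = ∫⁻ p, F p * g p := by
    rw [Measure.volume_eq_prod, lintegral_prod _ mg.aemeasurable]
  calc ∫⁻ p, F p ^ 4
      ≤ ∫⁻ p : ℝ × ℝ, (∫⁻ t, F (p.1, t) * g (p.1, t)) * (∫⁻ t, F (t, p.2) * f (t, p.2)) := by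
        refine lintegral_mono fun p => ?_
        have : F p ^ 4 = F p ^ 2 * F p ^ 2 := by ring
        rw [this]
        exact mul_le_mul' (h2 p.1 p.2) (h1 p.1 p.2)
    _ = (∫⁻ p, F p * g p) * (∫⁻ p, F p * f p) := by
        rw [Measure.volume_eq_prod, lintegral_prod_mul m2.aemeasurable m1.aemeasurable, e1, e2]
        rfl
    _ ≤ ((∫⁻ p, F p ^ 2) ^ (1 / 2 : ℝ) * (∫⁻ p, g p ^ 2) ^ (1 / 2 : ℝ)) *
        ((∫⁻ p, F p ^ 2) ^ (1 / 2 : ℝ) * (∫⁻ p, f p ^ 2) ^ (1 / 2 : ℝ)) :=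
        mul_le_mul' (lady_cs _ hF hg) (lady_cs _ hF hf)
    _ = ((∫⁻ p, F p ^ 2) ^ (1 / 2 : ℝ) * (∫⁻ p, F p ^ 2) ^ (1 / 2 : ℝ)) *
      ((∫⁻ p, f p ^ 2) ^ (1 / 2 : ℝ) * (∫⁻ p, g p ^ 2) ^ (1 / 2 : ℝ)) := by ring
    _ = _ := by rw [lady_half]

lemma lady_abs {A a b c : ℝ × ℝ × ℝ → ℝ≥0∞} (hA : Measurable A) (ha : Measurable a)
    (hb : Measurable b) (hc : Measurable c)
    (h0 : ∀ x y z, A (x, y, z) ^ 2 ≤ ∫⁻ t, A (t, y, z) * a (t, y, z))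
    (h1 : ∀ x y z, A (x, y, z) ^ 2 ≤ ∫⁻ t, A (x, t, z) * b (x, t, z))
    (h2 : ∀ x y z, A (x, y, z) ^ 2 ≤ ∫⁻ t, A (x, y, t) * c (x, y, t)) :
    ∫⁻ p, A p ^ 4 ≤ ((∫⁻ p, A p ^ 2) ^ (1 / 2 : ℝ) * (∫⁻ p, a p ^ 2) ^ (1 / 2 : ℝ)) *
      ((∫⁻ p, b p ^ 2) ^ (1 / 2 : ℝ) * (∫⁻ p, c p ^ 2) ^ (1 / 2 : ℝ)) := by
  have key : ∀ x, ∫⁻ p : ℝ × ℝ, A (x, p) ^ 2 ≤ ∫⁻ q, A q * a q := by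
    intro x
    calc ∫⁻ p : ℝ × ℝ, A (x, p) ^ 2 ≤ ∫⁻ p : ℝ × ℝ, ∫⁻ t : ℝ, A (t, p) * a (t, p) :=
          lintegral_mono fun p => h0 x p.1 p.2
      _ = _ := by
        rw [Measure.volume_eq_prod ℝ (ℝ × ℝ), lintegral_prod_symm (fun q => A q * a q) (hA.mul ha).aemeasurable]
  have fub : ∀ {f : ℝ × ℝ × ℝ → ℝ≥0∞}, Measurable f →
      ∫⁻ p, f p = ∫⁻ x : ℝ, ∫⁻ p : ℝ × ℝ, f (x, p) := by
    intro f hf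
    rw [Measure.volume_eq_prod ℝ (ℝ × ℝ), lintegral_prod _ hf.aemeasurable]
  have mb : Measurable fun x : ℝ => (∫⁻ p : ℝ × ℝ, b (x, p) ^ 2) :=
    (hb.pow_const 2).lintegral_prod_right'
  have mc : Measurable fun x : ℝ => (∫⁻ p : ℝ × ℝ, c (x, p) ^ 2) :=
    (hc.pow_const 2).lintegral_prod_right'
  calc ∫⁻ p, A p ^ 4 = ∫⁻ x : ℝ, ∫⁻ p : ℝ × ℝ, A (x, p) ^ 4 := fub (hA.pow_const 4)
    _ ≤ ∫⁻ x : ℝ, (∫⁻ q, A q * a q) * ((∫⁻ p : ℝ × ℝ, b (x, p) ^ 2) ^ (1 / 2 : ℝ) *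
          (∫⁻ p : ℝ × ℝ, c (x, p) ^ 2) ^ (1 / 2 : ℝ)) := by
        refine lintegral_mono fun x => ?_
        refine (lady_2d (F := fun p => A (x, p)) (f := fun p => b (x, p))
          (g := fun p => c (x, p)) (by fun_prop) (by fun_prop) (by fun_prop)
          (h1 x) (h2 x)).trans ?_
        exact mul_le_mul' (key x) le_rfl
    _ = (∫⁻ q, A q * a q) * ∫⁻ x : ℝ, ((∫⁻ p : ℝ × ℝ, b (x, p) ^ 2) ^ (1 / 2 : ℝ) *
          (∫⁻ p : ℝ × ℝ, c (x, p) ^ 2) ^ (1 / 2 : ℝ)) :=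
        lintegral_const_mul _ ((mb.pow_const _).mul (mc.pow_const _))
    _ ≤ _ := by
        refine mul_le_mul' (lady_cs _ hA ha) ?_
        refine (lady_cs _ (mb.pow_const _) (mc.pow_const _)).trans ?_
        simp only [lady_half_sq]
        rw [fub (hb.pow_const 2), fub (hc.pow_const 2)]

lemma lady_1d {w : ℝ → ℝ} (hw : ContDiff ℝ 1 w) (hs : HasCompactSupport w) (x : ℝ) :
    2 * ‖w x‖ₑ ≤ ∫⁻ t, ‖deriv w t‖ₑ := by
  have h1 := hs.enorm_le_lintegral_Ici_deriv hw x
  have h2 : ‖w x‖ₑ ≤ ∫⁻ y in Set.Ioi x, ‖deriv w y‖ₑ := by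
    have := hs.integral_Ioi_deriv_eq hw x
    rw [← enorm_neg, ← this]
    exact enorm_integral_le_lintegral_enorm _
  rw [two_mul, ← lintegral_add_compl _ (measurableSet_Iic (a := x)), Set.compl_Iic]
  exact add_le_add h1 h2

lemma lady_line (u : E3 → E3) (hu : ContDiff ℝ 1 u) (hsupp : HasCompactSupport u)
    (p v : E3) (hv : ‖v‖ = 1) :
    ‖u p‖ₑ ^ 2 ≤ ∫⁻ t : ℝ, ‖inner ℝ (u (p + t • v)) (fderiv ℝ u (p + t • v) v)‖ₑ := by
  have hv0 : v ≠ 0 := by rintro rfl; simp at hv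
  have hcl : Topology.IsClosedEmbedding (fun t : ℝ => p + t • v) := by
    have h1 := isClosedEmbedding_smul_left (𝕜 := ℝ) hv0
    exact (Homeomorph.addLeft p).isClosedEmbedding.comp h1
  have hc : HasCompactSupport (fun t : ℝ => u (p + t • v)) :=
    hsupp.comp_isClosedEmbedding hcl
  have hcd : ContDiff ℝ 1 (fun t : ℝ => u (p + t • v)) := by fun_prop
  have hw : ContDiff ℝ 1 (fun t : ℝ => ‖u (p + t • v)‖ ^ 2) := hcd.norm_sq ℝ
  have hws : HasCompactSupport (fun t : ℝ => ‖u (p + t • v)‖ ^ 2) :=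
    hc.comp_left (g := fun y : E3 => ‖y‖ ^ 2) (by simp)
  have hd : ∀ t : ℝ, deriv (fun t : ℝ => ‖u (p + t • v)‖ ^ 2) t =
      2 * inner ℝ (u (p + t • v)) (fderiv ℝ u (p + t • v) v) := by
    intro t
    have h1 : HasDerivAt (fun t : ℝ => p + t • v) v t := by
      simpa using ((hasDerivAt_id t).smul_const v).const_add p
    have h2 := ((hu.differentiable one_ne_zero (p + t • v)).hasFDerivAt).comp_hasDerivAt t h1
    exact h2.norm_sq.deriv
  have h := lady_1d hw hws 0
  simp only [hd, enorm_mul, zero_smul, add_zero] at h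
  have e2 : ‖(2 : ℝ)‖ₑ = 2 := by simp [enorm_eq_nnnorm]
  rw [lintegral_const_mul' _ _ (by simp), e2] at h
  have := (ENNReal.mul_le_mul_iff_right (by simp) (by simp)).1 h
  simpa using this

lemma lady_mp : MeasurePreserving (fun q : ℝ × ℝ × ℝ => (!₂[q.1, q.2.1, q.2.2] : E3)) := by
  have h1 := (volume_preserving_piFinSuccAbove (fun _ : Fin 3 => ℝ) 0).symm
  have h2 := (volume_preserving_finTwoArrow ℝ).symm
  have h3 := PiLp.volume_preserving_toLp (Fin 3)
  have h4 := h3.comp (h1.comp ((MeasurePreserving.id (volume : Measure ℝ)).prod h2))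
  convert h4 using 1
  · ext q i
    fin_cases i <;> rfl
  · rfl

lemma lady_lint {f : E3 → ℝ≥0∞} (hf : Measurable f) :
    ∫⁻ q : ℝ × ℝ × ℝ, f !₂[q.1, q.2.1, q.2.2] = ∫⁻ x, f x :=
  lady_mp.lintegral_comp hf

/-- the length of the `i`-th derivative of `‖u‖`. -/
noncomputable def ladyG (u : E3 → E3) (i : Fin 3) (x : E3) : ℝ≥0∞ :=
  ENNReal.ofReal (|inner ℝ (u x) (fderiv ℝ u x (EuclideanSpace.single i 1))| / ‖u x‖)

lemma ladyG_meas (u : E3 → E3) (hu : ContDiff ℝ 1 u) (i : Fin 3) : Measurable (ladyG u i) := by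
  have h1 : Continuous fun x => fderiv ℝ u x (EuclideanSpace.single i 1) :=
    (hu.continuous_fderiv one_ne_zero).clm_apply continuous_const
  have h2 : Continuous fun x => |inner ℝ (u x) (fderiv ℝ u x (EuclideanSpace.single i 1))| :=
    (hu.continuous.inner h1).abs
  exact (h2.measurable.div hu.continuous.norm.measurable).ennreal_ofReal

lemma ladyG_mul (u : E3 → E3) (i : Fin 3) (x : E3) :
    ‖u x‖ₑ * ladyG u i x = ‖inner ℝ (u x) (fderiv ℝ u x (EuclideanSpace.single i 1))‖ₑ := by
  rw [ladyG, ← ofReal_norm, ← ofReal_norm, ← ENNReal.ofReal_mul (norm_nonneg _)]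
  congr 1
  by_cases h : u x = 0
  · simp [h]
  · rw [mul_div_cancel₀ _ (norm_ne_zero_iff.2 h), Real.norm_eq_abs]

lemma ladyG_sum (u : E3 → E3) (x : E3) :
    ladyG u 0 x ^ 2 + ladyG u 1 x ^ 2 + ladyG u 2 x ^ 2 ≤ ‖fderiv ℝ u x‖ₑ ^ 2 := by
  simp only [ladyG, ← ofReal_norm]
  rw [← ENNReal.ofReal_pow (by positivity), ← ENNReal.ofReal_pow (by positivity),
    ← ENNReal.ofReal_pow (by positivity), ← ENNReal.ofReal_pow (by positivity),
    ← ENNReal.ofReal_add (by positivity) (by positivity),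
    ← ENNReal.ofReal_add (by positivity) (by positivity)]
  apply ENNReal.ofReal_le_ofReal
  simp only [div_pow, sq_abs]
  rw [← add_div, ← add_div]
  apply div_le_of_le_mul₀ (by positivity) (by positivity)
  rw [← mul_pow]
  set L := fderiv ℝ u x
  have h1 := (EuclideanSpace.basisFun (Fin 3) ℝ).sum_sq_norm_inner_left
    (ContinuousLinearMap.adjoint L (u x))
  simp only [Fin.sum_univ_three, EuclideanSpace.basisFun_apply,
    ContinuousLinearMap.adjoint_inner_left, Real.norm_eq_abs, sq_abs] at h1
  rw [h1]
  refine pow_le_pow_left₀ (norm_nonneg _) ?_ 2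
  simpa using (ContinuousLinearMap.adjoint L).le_opNorm (u x)

lemma lady_enn (u : E3 → E3) (hu : ContDiff ℝ 1 u) (hsupp : HasCompactSupport u) :
    ∫⁻ x, ‖u x‖ₑ ^ 4 ≤
      ((∫⁻ x, ‖u x‖ₑ ^ 2) ^ (1 / 2 : ℝ) * (∫⁻ x, ladyG u 0 x ^ 2) ^ (1 / 2 : ℝ)) *
      ((∫⁻ x, ladyG u 1 x ^ 2) ^ (1 / 2 : ℝ) * (∫⁻ x, ladyG u 2 x ^ 2) ^ (1 / 2 : ℝ)) := by
  have mA : Measurable fun x => ‖u x‖ₑ := hu.continuous.measurable.enorm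
  have mG := ladyG_meas u hu
  have hm := lady_mp.measurable
  have := lady_abs (mA.comp hm) ((mG 0).comp hm) ((mG 1).comp hm) ((mG 2).comp hm) ?_ ?_ ?_
  · simp only [Function.comp_def] at this
    rwa [lady_lint (mA.pow_const 4), lady_lint (mA.pow_const 2), lady_lint ((mG 0).pow_const 2),
      lady_lint ((mG 1).pow_const 2), lady_lint ((mG 2).pow_const 2)] at this
  · intro x y z
    simp only [Function.comp_def, ladyG_mul]
    refine (lady_line u hu hsupp _ (EuclideanSpace.single 0 1) (by simp)).trans_eq ?_
    rw [← lintegral_add_left_eq_self (fun t => ‖inner ℝ (u !₂[t, y, z]) ((fderiv ℝ u !₂[t, y, z]) (EuclideanSpace.single 0 1))‖ₑ) x]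
    refine lintegral_congr fun t => ?_
    have : (!₂[x, y, z] : E3) + t • EuclideanSpace.single 0 1 = !₂[x + t, y, z] := by
      ext i; fin_cases i <;> simp
    rw [this]
  · intro x y z
    simp only [Function.comp_def, ladyG_mul]
    refine (lady_line u hu hsupp _ (EuclideanSpace.single 1 1) (by simp)).trans_eq ?_
    rw [← lintegral_add_left_eq_self (fun t => ‖inner ℝ (u !₂[x, t, z]) ((fderiv ℝ u !₂[x, t, z]) (EuclideanSpace.single 1 1))‖ₑ) y]
    refine lintegral_congr fun t => ?_
    have : (!₂[x, y, z] : E3) + t • EuclideanSpace.single 1 1 = !₂[x, y + t, z] := by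
      ext i; fin_cases i <;> simp
    rw [this]
  · intro x y z
    simp only [Function.comp_def, ladyG_mul]
    refine (lady_line u hu hsupp _ (EuclideanSpace.single 2 1) (by simp)).trans_eq ?_
    rw [← lintegral_add_left_eq_self (fun t => ‖inner ℝ (u !₂[x, y, t]) ((fderiv ℝ u !₂[x, y, t]) (EuclideanSpace.single 2 1))‖ₑ) z]
    refine lintegral_congr fun t => ?_
    have : (!₂[x, y, z] : E3) + t • EuclideanSpace.single 2 1 = !₂[x, y, z + t] := by
      ext i; fin_cases i <;> simp
    rw [this]

lemma lady_norm {F : Type*} [NormedAddCommGroup F] (f : E3 → F) (n : ℕ) (hn : n ≠ 0) :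
    (eLpNorm f n volume).toReal ^ n = (∫⁻ x, ‖f x‖ₑ ^ n).toReal := by
  have h := eLpNorm_nnreal_pow_eq_lintegral (μ := volume) (f := f) (p := (n : NNReal))
    (by exact_mod_cast hn)
  simp only [NNReal.coe_natCast, ENNReal.rpow_natCast, ENNReal.coe_natCast] at h
  rw [← h, ENNReal.toReal_pow]

/-- Ladyzhenskaya-type inequality in 3d: for a compactly supported C¹ vector field
`u : ℝ³ → ℝ³`, `‖u‖_{L⁴} ≤ (4/(3√3))^{3/4} ‖u‖_{L²}^{1/4} ‖∇u‖_{L²}^{3/4}`. -/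
theorem ladyzhenskaya_3d
    (u : EuclideanSpace ℝ (Fin 3) → EuclideanSpace ℝ (Fin 3))
    (hu : ContDiff ℝ 1 u) (hsupp : HasCompactSupport u) :
    (eLpNorm u 4 volume).toReal ≤
      (4 / (3 * Real.sqrt 3)) ^ ((3 : ℝ) / 4) *
        (eLpNorm u 2 volume).toReal ^ ((1 : ℝ) / 4) *
        (eLpNorm (fun x => ‖fderiv ℝ u x‖) 2 volume).toReal ^ ((3 : ℝ) / 4) := by
  have n4 := lady_norm u 4 (by norm_num)
  have n2 := lady_norm u 2 (by norm_num)
  have nD := lady_norm (fun x => ‖fderiv ℝ u x‖) 2 (by norm_num)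
  simp only [Nat.cast_ofNat, enorm_norm] at n4 n2 nD
  have hcD : Continuous (fun x => fderiv ℝ u x) := hu.continuous_fderiv one_ne_zero
  have fD : ∫⁻ x, ‖fderiv ℝ u x‖ₑ ^ 2 ≠ ∞ := by
    have h1 : MemLp (fun x => fderiv ℝ u x) 2 volume :=
      hcD.memLp_of_hasCompactSupport (hsupp.fderiv (𝕜 := ℝ))
    have h := eLpNorm_nnreal_pow_eq_lintegral (μ := volume) (f := fun x => fderiv ℝ u x)
      (p := (2 : NNReal)) (by norm_num)
    have h2 : eLpNorm (fun x => fderiv ℝ u x) 2 volume ≠ ∞ := h1.2.ne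
    simp at h
    rw [← h]
    simpa using h2
  have f2 : ∫⁻ x, ‖u x‖ₑ ^ 2 ≠ ∞ := by
    have h1 : MemLp u 2 volume :=
      hu.continuous.memLp_of_hasCompactSupport hsupp
    have h := eLpNorm_nnreal_pow_eq_lintegral (μ := volume) (f := u)
      (p := (2 : NNReal)) (by norm_num)
    have h2 : eLpNorm u 2 volume ≠ ∞ := h1.2.ne
    simp at h
    rw [← h]
    simpa using h2
  have hmain := lady_enn u hu hsupp
  have mG := ladyG_meas u hu
  have hsum : (∫⁻ x, ladyG u 0 x ^ 2) + (∫⁻ x, ladyG u 1 x ^ 2) + (∫⁻ x, ladyG u 2 x ^ 2) ≤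
      ∫⁻ x, ‖fderiv ℝ u x‖ₑ ^ 2 := by
    rw [← lintegral_add_left ((mG 0).pow_const 2),
      ← lintegral_add_right _ ((mG 2).pow_const 2)]
    exact lintegral_mono fun x => ladyG_sum u x
  generalize (∫⁻ x, ladyG u 0 x ^ 2) = a at hsum hmain
  generalize (∫⁻ x, ladyG u 1 x ^ 2) = b at hsum hmain
  generalize (∫⁻ x, ladyG u 2 x ^ 2) = c at hsum hmain
  generalize (∫⁻ x, ‖fderiv ℝ u x‖ₑ ^ 2) = D at *
  generalize (∫⁻ x, ‖u x‖ₑ ^ 2) = S at *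
  generalize (∫⁻ x, ‖u x‖ₑ ^ 4) = T at *
  have fabc := ne_top_of_le_ne_top fD hsum
  have fc : c ≠ ∞ := fun h => fabc (by simp [h])
  have fb : b ≠ ∞ := fun h => fabc (by simp [h])
  have fa : a ≠ ∞ := fun h => fabc (by simp [h])
  have hsumR := ENNReal.toReal_mono fD hsum
  rw [ENNReal.toReal_add (by simp [fa, fb]) fc, ENNReal.toReal_add fa fb] at hsumR
  have hh : ∀ {x : ℝ≥0∞}, x ≠ ∞ → x ^ (1 / 2 : ℝ) ≠ ∞ := fun h =>
    ENNReal.rpow_ne_top_of_nonneg (by norm_num) h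
  have hmR := ENNReal.toReal_mono (ENNReal.mul_ne_top (ENNReal.mul_ne_top (hh f2) (hh fa))
    (ENNReal.mul_ne_top (hh fb) (hh fc))) hmain
  simp only [ENNReal.toReal_mul, ← ENNReal.toReal_rpow, ← Real.sqrt_eq_rpow] at hmR
  rw [← n4, ← n2] at hmR
  rw [← nD] at hsumR
  have ha := ENNReal.toReal_nonneg (a := a)
  have hb := ENNReal.toReal_nonneg (a := b)
  have hc := ENNReal.toReal_nonneg (a := c)
  generalize a.toReal = a' at *
  generalize b.toReal = b' at *
  generalize c.toReal = c' at *
  have p4 := ENNReal.toReal_nonneg (a := eLpNorm u 4 volume)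
  have p2 := ENNReal.toReal_nonneg (a := eLpNorm u 2 volume)
  have pD := ENNReal.toReal_nonneg (a := eLpNorm (fun x => ‖fderiv ℝ u x‖) 2 volume)
  generalize (eLpNorm u 4 volume).toReal = X at *
  generalize (eLpNorm u 2 volume).toReal = Y at *
  generalize (eLpNorm (fun x => ‖fderiv ℝ u x‖) 2 volume).toReal = Z at *
  rw [Real.sqrt_sq p2] at hmR
  set k : ℝ := 4 / (3 * Real.sqrt 3) with hk
  have hk0 : 0 ≤ k := by positivity
  have hk2 : k ^ 2 = 16 / 27 := by
    rw [hk, div_pow, mul_pow, Real.sq_sqrt (by norm_num)]; norm_num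
  have habc : a' * b' * c' ≤ (k ^ 3 * Z ^ 3) ^ 2 := by
    have e : (k ^ 3 * Z ^ 3) ^ 2 = (16 / 27) ^ 3 * (Z ^ 2) ^ 3 := by rw [← hk2]; ring
    rw [e]
    have h3 : (a' + b' + c') ^ 3 ≤ (Z ^ 2) ^ 3 := pow_le_pow_left₀ (by positivity) hsumR 3
    have h6 : 6 * (a' * b' * c') ≤ (a' + b' + c') ^ 3 := by
      have : (a' + b' + c') ^ 3 = 6 * (a' * b' * c') + (a'^3 + b'^3 + c'^3 + 3 * a'^2 * b'
        + 3 * a'^2 * c' + 3 * b'^2 * a' + 3 * b'^2 * c' + 3 * c'^2 * a' + 3 * c'^2 * b') := by ring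
      rw [this]
      exact le_add_of_nonneg_right (by positivity)
    have : 0 ≤ (Z ^ 2) ^ 3 := by positivity
    nlinarith
  have hs : √a' * (√b' * √c') ≤ k ^ 3 * Z ^ 3 := by
    rw [← Real.sqrt_mul hb, ← Real.sqrt_mul ha, ← mul_assoc]
    exact Real.sqrt_le_iff.2 ⟨by positivity, habc⟩
  have hX : X ^ 4 ≤ k ^ 3 * Y * Z ^ 3 := by
    calc X ^ 4 ≤ _ := hmR
      _ = Y * (√a' * (√b' * √c')) := by ring
      _ ≤ Y * (k ^ 3 * Z ^ 3) := mul_le_mul_of_nonneg_left hs p2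
      _ = _ := by ring
  refine le_of_pow_le_pow_left₀ (n := 4) (by norm_num) (by positivity) ?_
  refine hX.trans_eq ?_
  have r3 : ∀ {x : ℝ}, 0 ≤ x → (x ^ ((3 : ℝ) / 4)) ^ 4 = x ^ 3 := by
    intro x hx
    rw [← Real.rpow_natCast, ← Real.rpow_mul hx, ← Real.rpow_natCast]; norm_num
  have r1 : (Y ^ ((1 : ℝ) / 4)) ^ 4 = Y := by
    rw [← Real.rpow_natCast, ← Real.rpow_mul p2]; norm_num
  rw [mul_pow, mul_pow, r3 hk0, r3 pD, r1]
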